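/- Fix k ≥ 2 and let S_k = [k+1] ++ (concatenation over i = 1, …, k of [1, 2, …, i] ++ [k+1+i]) be the string over ℕ with digits 1, …, k and barred characters b̄_j = k + j. For every i with 1 ≤ i ≤ k − 1, the set of left-extensions of the maximal substring [1, 2, …, i] equals { c : c·[1, 2, …, i] ∈ Substr(S_k) } = { k+j : i ≤ j ≤ k } (the barred characters b̄_i, b̄_{i+1}, …, b̄_k). -/

import Mathlib

def Substr {α : Type*} (T w : List α) : Prop := ∃ x z : List α, T = x ++ w ++ z

def RightM {α : Type*} (T : List α) : Set (List α) :=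
  {w | Substr T w ∧ ((∃ a b : α, a ≠ b ∧ Substr T (w ++ [a]) ∧ Substr T (w ++ [b])) ∨ w <:+ T)}

def Sk (k : ℕ) : List ℕ :=
  (k + 1) :: ((List.range k).map (fun i => ((List.range (i + 1)).map (· + 1)) ++ [k + 2 + i])).flatten

/-- An occurrence of `c :: w` in `A ++ h :: t` cannot straddle the boundary if `h` is not in `w`. -/
theorem infix_append_cons_of_notMem {α : Type*} {c h : α} {w A t : List α} (hw : h ∉ w)
    (H : (c :: w) <:+: A ++ h :: t) : (c :: w) <:+: A ∨ (c :: w) <:+: h :: t := by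
  rcases List.infix_append_iff.1 H with H | H | ⟨t₁, t₂, e, h₁, h₂⟩
  · exact .inl H
  · exact .inr H
  · cases t₂ with
    | nil => left; rw [e, List.append_nil]; exact h₁.isInfix
    | cons a t₂ =>
      obtain rfl := (List.cons_prefix_cons.1 h₂).1
      cases t₁ with
      | nil => right; rw [e]; exact h₂.isInfix
      | cons b t₁ =>
        rw [List.cons_append, List.cons.injEq] at e
        exact absurd (by simp [e.2]) hw

theorem Sk_regroup (k n : ℕ) :
    (k + 1) :: ((List.range n).map
      (fun i => ((List.range (i + 1)).map (· + 1)) ++ [k + 2 + i])).flatten =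
    ((List.range n).map
      (fun m => (k + 1 + m) :: (List.range (m + 1)).map (· + 1))).flatten ++ [k + 1 + n] := by
  induction n with
  | zero => simp
  | succ n ih =>
    rw [List.range_succ, List.map_append, List.flatten_append, ← List.cons_append, ih,
      List.map_append, List.flatten_append]
    simp
    omega

/-- `1` is not preceded by any character in `[1, …, m]`. -/
theorem not_cons_infix_map_range {c i m : ℕ} (hi : 1 ≤ i) :
    ¬ (c :: (List.range i).map (· + 1)) <:+: (List.range m).map (· + 1) := by
  intro H
  have hp : ((List.range m).map (· + 1)).Pairwise (· < ·) := by
    rw [List.pairwise_map]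
    exact List.pairwise_lt_range.imp (by intro a b h; omega)
  have h1 := List.rel_of_pairwise_cons (hp.sublist H.sublist)
    (List.mem_map_of_mem (f := (· + 1)) (List.mem_range.2 hi))
  have hc := H.subset List.mem_cons_self
  simp at hc h1
  omega

theorem left_extension_of_infix_flatten {k c i n : ℕ} (hi : 1 ≤ i) (hik : i ≤ k)
    (H : (c :: (List.range i).map (· + 1)) <:+: ((List.range n).map
      (fun m => (k + 1 + m) :: (List.range (m + 1)).map (· + 1))).flatten) :
    ∃ m < n, i ≤ m + 1 ∧ c = k + 1 + m := by
  induction n with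
  | zero => simp at H
  | succ n ih =>
    rw [List.range_succ, List.map_append, List.flatten_append, List.map_singleton,
      List.flatten_singleton] at H
    have hw : k + 1 + n ∉ (List.range i).map (· + 1) := by
      simp only [List.mem_map, List.mem_range, not_exists]
      omega
    rcases infix_append_cons_of_notMem hw H with H | H
    · obtain ⟨m, hm, h⟩ := ih H
      exact ⟨m, by omega, h⟩
    · rcases List.infix_cons_iff.1 H with H | H
      · have hl := H.length_le
        simp only [List.length_cons, List.length_map, List.length_range] at hl
        exact ⟨n, by omega, by omega, (List.cons_prefix_cons.1 H).1⟩
      · exact absurd H (not_cons_infix_map_range hi)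

theorem substr_iff_infix {α : Type*} {T w : List α} : Substr T w ↔ w <:+: T :=
  ⟨fun ⟨x, z, h⟩ => ⟨x, z, h.symm⟩, fun ⟨x, z, h⟩ => ⟨x, z, h.symm⟩⟩

theorem left_extensions_Sk (k : ℕ) (hk : 2 ≤ k) (i : ℕ) (hi1 : 1 ≤ i) (hik : i ≤ k - 1) :
    {c : ℕ | Substr (Sk k) (c :: ((List.range i).map (· + 1)))} =
      {c : ℕ | ∃ j : ℕ, i ≤ j ∧ j ≤ k ∧ c = k + j} := by
  ext c
  simp only [Set.mem_ofPred_eq, substr_iff_infix, Sk, Sk_regroup]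
  constructor
  · intro H
    have hw : k + 1 + k ∉ (List.range i).map (· + 1) := by
      simp only [List.mem_map, List.mem_range, not_exists]
      omega
    rcases infix_append_cons_of_notMem hw H with H | H
    · obtain ⟨m, hm, him, rfl⟩ := left_extension_of_infix_flatten hi1 (by omega) H
      exact ⟨m + 1, him, hm, by omega⟩
    · have hl := H.length_le
      simp only [List.length_cons, List.length_map, List.length_range, List.length_nil] at hl
      omega
  · rintro ⟨j, hij, hjk, rfl⟩
    obtain ⟨m, rfl⟩ : ∃ m, j = m + 1 := ⟨j - 1, by omega⟩
    obtain ⟨d, hd⟩ := Nat.exists_eq_add_of_le hij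
    have hblock : ((k + (m + 1)) :: (List.range i).map (· + 1)) <+:
        (k + 1 + m) :: (List.range (m + 1)).map (· + 1) := by
      rw [hd, List.range_add, List.map_append, List.cons_prefix_cons]
      exact ⟨by omega, List.prefix_append _ _⟩
    refine hblock.isInfix.trans (List.IsInfix.trans ?_ (List.prefix_append _ _).isInfix)
    exact List.infix_of_mem_flatten (List.mem_map.2 ⟨m, List.mem_range.2 hjk, rfl⟩)
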